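/- Let m ≥ 1 and let (a, d) = ((a_0,…,a_{m-1}), d) be a minimal norm pair of length m. Then: (1) a_i + j < a_{i+j} for all 0 ≤ i < m and 1 ≤ j < m - i with a_i ≠ -∞ and a_{i+j} ≠ -∞, except possibly in the case p = 2, m ≥ 2, d ∉ U_2, and i = a_i = 0; (2) if either (p > 2 or d ∈ U_2) and d ∈ U_t \ U_{t+1} for some t with 1 ≤ t < m, or p = 2 and d ∈ -U_t \ -U_{t+1} for some t ≥ 2, then a_{t+k} > k for every 0 ≤ k < m - t with a_{t+k} ≠ -∞; (3) if p = 2, a_0 = 0, and d ∈ -U_t \ -U_{t+1} for some t ≥ 2, then a_{t+k-1} > k for every 0 ≤ k ≤ m - t with a_{t+k-1} ≠ -∞. -/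

import Mathlib

/-!
Common setup.  Throughout, `K/F` is a cyclic Galois extension of degree `p^n`
with Galois group `G = Gal(K/F)` generated by `σ`.  For `0 ≤ i ≤ n`, `K_i`
denotes the intermediate field of degree `p^i` over `F`, realized here via its
unit group `KiU p σ i` (the units of `K` fixed by `σ^{p^i}`), and
`G_i = Gal(K_i/F)`.  For `m ≥ 1`, `R_m = ℤ/p^m` and `J_m = K^×/K^{×p^m}`.
-/

namespace MSS

variable {F K : Type*} [Field F] [Field K] [Algebra F K]

/-- Action of a field automorphism on the unit group. -/
def umap (σ : K ≃ₐ[F] K) : Kˣ →* Kˣ := Units.map (σ : K →* K)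

/-- The norm from `K_j` to `F`, computed in `K` as the product of conjugates
`∏_{k < p^j} σ^k(γ)` (valid for `γ ∈ K_j`). -/
noncomputable def normHom (p : ℕ) (σ : K ≃ₐ[F] K) (j : ℕ) : Kˣ →* Kˣ :=
  ∏ k ∈ Finset.range (p ^ j), umap (σ ^ k)

/-- The unit group of the intermediate field `K_i`: the units fixed by `σ^{p^i}`. -/
def KiU (p : ℕ) (σ : K ≃ₐ[F] K) (i : ℕ) : Subgroup Kˣ :=
  (umap (σ ^ p ^ i) / MonoidHom.id Kˣ).ker

/-- Membership in `K_a^×` for a level `a ∈ {-∞, 0, 1, …}`; level `-∞` means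
the trivial group `{1}`. -/
def levelMem (p : ℕ) (σ : K ≃ₐ[F] K) (a : WithBot ℕ) (γ : Kˣ) : Prop :=
  WithBot.recBotCoe (γ = 1) (fun i => γ ∈ KiU p σ i) a

/-- `(α, δ)` represents the pair `(a, d)`:  `σ(α)·α^{-d} = ∏_{i=0}^m δ_i^{p^i}` with
`δ_i ∈ K_{a_i}^×` for `i < m`, and
`ξ_p = N_{K/F}(α)^{(d-1)/p} · N_{K_{n-1}/F}(δ_0) · ∏_{i=1}^m N_{K/F}(δ_i)^{p^{i-1}}`. -/
noncomputable def Represents (p n : ℕ) (σ : K ≃ₐ[F] K) (ξ : Kˣ) {m : ℕ}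
    (a : Fin m → WithBot ℕ) (d : ℤ) (α : Kˣ) (δ : ℕ → Kˣ) : Prop :=
  (∀ i : Fin m, levelMem p σ (a i) (δ i)) ∧
  umap σ α = α ^ d * ∏ i ∈ Finset.range (m + 1), δ i ^ p ^ i ∧
  ξ = normHom p σ n α ^ ((d - 1) / (p : ℤ)) * normHom p σ (n - 1) (δ 0) *
      ∏ i ∈ Finset.Icc 1 m, normHom p σ n (δ i) ^ p ^ (i - 1)

/-- `(a, d)` is a norm pair of length `m`: `a ∈ {-∞,0,…,n}^m` with `a_0 < n`,
`d ∈ U_1`, and some `(α, δ)` represents `(a, d)`. -/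
noncomputable def IsNormPair (p n : ℕ) (σ : K ≃ₐ[F] K) (ξ : Kˣ) {m : ℕ}
    (a : Fin m → WithBot ℕ) (d : ℤ) : Prop :=
  (∀ i, a i ≤ (n : WithBot ℕ)) ∧
  (∀ h0 : 0 < m, a ⟨0, h0⟩ < (n : WithBot ℕ)) ∧
  (p : ℤ) ∣ d - 1 ∧
  ∃ (α : Kˣ) (δ : ℕ → Kˣ), Represents p n σ ξ a d α δ

/-- Strict lexicographic order on norm vectors (with `-∞` smallest). -/
def vecLT {m : ℕ} (a a' : Fin m → WithBot ℕ) : Prop :=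
  ∃ k : Fin m, (∀ j : Fin m, j < k → a j = a' j) ∧ a k < a' k

/-- The order `d ≤_m d'` on twists: `d' ∈ U_i → d ∈ U_i` for `1 ≤ i ≤ m`, except
when `p = 2` and `d, d' ∉ U_2`, in which case `d' ∈ -U_i → d ∈ -U_i` for `2 ≤ i ≤ m`. -/
def twistLE (p m : ℕ) (d d' : ℤ) : Prop :=
  ((p = 2 ∧ ¬ (4 : ℤ) ∣ (d - 1) ∧ ¬ (4 : ℤ) ∣ (d' - 1)) →
    ∀ i : ℕ, 2 ≤ i → i ≤ m → ((2 : ℤ) ^ i ∣ (d' + 1)) → ((2 : ℤ) ^ i ∣ (d + 1))) ∧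
  (¬ (p = 2 ∧ ¬ (4 : ℤ) ∣ (d - 1) ∧ ¬ (4 : ℤ) ∣ (d' - 1)) →
    ∀ i : ℕ, 1 ≤ i → i ≤ m → ((p : ℤ) ^ i ∣ (d' - 1)) → ((p : ℤ) ^ i ∣ (d - 1)))

/-- The order `⪯_m` on norm pairs of length `m`. -/
def pairLE (p : ℕ) {m : ℕ} (a : Fin m → WithBot ℕ) (d : ℤ)
    (a' : Fin m → WithBot ℕ) (d' : ℤ) : Prop :=
  vecLT a a' ∨ (a = a' ∧ twistLE p m d d')

/-- `(a, d)` is a minimal norm pair of length `m`. -/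
noncomputable def IsMinimalNormPair (p n : ℕ) (σ : K ≃ₐ[F] K) (ξ : Kˣ) {m : ℕ}
    (a : Fin m → WithBot ℕ) (d : ℤ) : Prop :=
  IsNormPair p n σ ξ a d ∧
  ∀ (a' : Fin m → WithBot ℕ) (d' : ℤ), IsNormPair p n σ ξ a' d' → pairLE p a d a' d'

/-- `α` is an `m`-exceptional element. -/
noncomputable def IsExceptional (p n : ℕ) (σ : K ≃ₐ[F] K) (ξ : Kˣ) (m : ℕ) (α : Kˣ) : Prop :=
  ∃ (a : Fin m → WithBot ℕ) (d : ℤ) (δ : ℕ → Kˣ),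
    IsMinimalNormPair p n σ ξ a d ∧ Represents p n σ ξ a d α δ

/-- The subgroup of `q`-th powers in `K^×`. -/
def powSub (K : Type*) [Field K] (q : ℕ) : Subgroup Kˣ := (powMonoidHom q : Kˣ →* Kˣ).range

/-- The class of a unit in `J_q := K^×/K^{×q}`. -/
def jcls (q : ℕ) (γ : Kˣ) : Kˣ ⧸ powSub K q := QuotientGroup.mk γ

/-- The action of a field automorphism on `J_q = K^×/K^{×q}`. -/
noncomputable def jmap (q : ℕ) (τ : K ≃ₐ[F] K) : (Kˣ ⧸ powSub K q) →* Kˣ ⧸ powSub K q :=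
  QuotientGroup.map _ _ (umap τ) (by
    rintro x ⟨y, rfl⟩
    exact ⟨umap τ y, by simp [powMonoidHom, map_pow]⟩)

/-- The natural map `J_q → J_{q'}` when `q' ∣ q`. -/
noncomputable def resMap (q q' : ℕ) (h : q' ∣ q) : (Kˣ ⧸ powSub K q) →* Kˣ ⧸ powSub K q' :=
  QuotientGroup.map _ _ (MonoidHom.id Kˣ) (by
    rintro x ⟨y, rfl⟩
    obtain ⟨c, rfl⟩ := h
    exact ⟨y ^ c, by simp [powMonoidHom, ← pow_mul, mul_comm]⟩)

/-- The `R_m[G]`-submodule of `J_q` generated by the classes of the elements of `S`: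
the subgroup generated by all `σ^k`-conjugates of classes of elements of `S`. -/
noncomputable def galSpan (q : ℕ) (σ : K ≃ₐ[F] K) (S : Set Kˣ) : Subgroup (Kˣ ⧸ powSub K q) :=
  Subgroup.closure {x | ∃ γ ∈ S, ∃ k : ℕ, x = jcls q (umap (σ ^ k) γ)}

/-- The subgroup `(σ-1)J_q` of `J_q`. -/
noncomputable def augSub (q : ℕ) (σ : K ≃ₐ[F] K) : Subgroup (Kˣ ⧸ powSub K q) :=
  Subgroup.closure {x | ∃ y : Kˣ ⧸ powSub K q, x = jmap q σ y * y⁻¹}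

/-- The cyclic `F_p[G]`-submodule of `J_1 = K^×/K^{×p}` generated by `[γ]_1` is a
free `F_p[G_i]`-module (on the generator `[γ]_1`): `[γ]_1` is fixed by `σ^{p^i}`
and the conjugates `σ^k [γ]_1`, `k < p^i`, are `F_p`-linearly independent. -/
noncomputable def FreeCyc (p : ℕ) (σ : K ≃ₐ[F] K) (i : ℕ) (γ : Kˣ) : Prop :=
  jcls p (umap (σ ^ p ^ i) γ) = jcls p γ ∧
  ∀ c : Fin (p ^ i) → ZMod p,
    (∏ k : Fin (p ^ i), jcls p (umap (σ ^ (k : ℕ)) γ) ^ (c k).val) = 1 → c = 0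

/-- An (indexed) internal direct sum decomposition of a commutative group. -/
def IsDirectSumDecomp {G : Type*} [CommGroup G] {ι : Sort*} (f : ι → Subgroup G) : Prop :=
  iSupIndep f ∧ (⨆ i, f i) = ⊤

/-- The subgroup `F^×` of `K^×` (units coming from the base field). -/
def Funits (F : Type*) {K : Type*} [Field F] [Field K] [Algebra F K] : Subgroup Kˣ :=
  (Units.map (algebraMap F K : F →* K)).range

/-- The subgroup `F^{×p}` of `K^×`. -/
def FpPow (F : Type*) {K : Type*} [Field F] [Field K] [Algebra F K] (p : ℕ) : Subgroup Kˣ :=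
  (Funits F).map (powMonoidHom p)

/-- The subgroup `N_{K_i/F}(K_i^×)` of `K^×`. -/
noncomputable def NormSub (p : ℕ) (σ : K ≃ₐ[F] K) (i : ℕ) : Subgroup Kˣ :=
  (KiU p σ i).map (normHom p σ i)

/-- The subgroup `N_{K_i/F}(K_i^×)·F^{×p}` of `K^×`. -/
noncomputable def NiF (p : ℕ) (σ : K ≃ₐ[F] K) (i : ℕ) : Subgroup Kˣ :=
  NormSub p σ i ⊔ FpPow F p

/-- The `F_p`-dimension of an (elementary abelian `p`-) commutative group `Q`,
computed as the rank of `F_p ⊗_ℤ Q`. -/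
noncomputable def fpdim (p : ℕ) (Q : Type*) [CommGroup Q] : Cardinal :=
  Module.rank (ZMod p) (TensorProduct ℤ (ZMod p) (Additive Q))

/-- The invariant `e_i(K/F)`: for `i < n` the `F_p`-dimension of
`N_{K_i/F}(K_i^×)F^{×p} / N_{K_{i+1}/F}(K_{i+1}^×)F^{×p}`, and for `i = n` the
`F_p`-dimension of `N_{K/F}(K^×)F^{×p}/F^{×p}`. -/
noncomputable def eKF (p n : ℕ) (σ : K ≃ₐ[F] K) (i : ℕ) : Cardinal :=
  if i < n then
    fpdim p ((NiF p σ i) ⧸ (NiF p σ (i + 1)).subgroupOf (NiF p σ i))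
  else
    fpdim p ((NiF p σ n) ⧸ (FpPow F p).subgroupOf (NiF p σ n))

/-- The group ring `R_m[G_i] = (ℤ/p^m)[ℤ/p^i]` (for the cyclic group `G_i` of order
`p^i`). -/
abbrev CycGR (p m i : ℕ) : Type :=
  MonoidAlgebra (ZMod (p ^ m)) (Multiplicative (ZMod (p ^ i)))

/-- The image of the generator `σ` of `G_i` in the group ring `R_m[G_i]`. -/
noncomputable def gen (p m i : ℕ) : CycGR p m i :=
  MonoidAlgebra.of _ _ (Multiplicative.ofAdd (1 : ZMod (p ^ i)))

/-- Standard basis vector of the free `R_m[G]`-module on generators `e_0, …, e_m`. -/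
noncomputable def sing (p n m : ℕ) (j : Fin (m + 1)) (c : CycGR p m n) :
    Fin (m + 1) → CycGR p m n :=
  Pi.single j c

/-- The relations defining the module `X_{a,d,m}`: on generators `y = e_0` and
`x_i = e_{i+1}` (`0 ≤ i < m`), we impose `(σ - d)·y = Σ_i p^i x_i`, and
`(σ^{p^{a_i}} - 1)·x_i = 0` when `a_i ≠ -∞`, resp. `x_i = 0` when `a_i = -∞`. -/
noncomputable def XRels (p n m : ℕ) (a : Fin m → WithBot ℕ) (d : ℤ) :
    Set (Fin (m + 1) → CycGR p m n) :=
  insert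
    (sing p n m 0 (gen p m n - (d : ZMod (p ^ m)) • 1) -
      ∑ i : Fin m, sing p n m i.succ ((p : CycGR p m n) ^ (i : ℕ)))
    {r | ∃ i : Fin m, r = sing p n m i.succ
      (WithBot.recBotCoe (1 : CycGR p m n) (fun k => gen p m n ^ p ^ k - 1) (a i))}

/-- The `R_m[G]`-module `X_{a,d,m}`. -/
noncomputable abbrev Xadm (p n m : ℕ) (a : Fin m → WithBot ℕ) (d : ℤ) :=
  (Fin (m + 1) → CycGR p m n) ⧸ Submodule.span (CycGR p m n) (XRels p n m a d)

/-- Indecomposability of a module. -/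
def IsIndecomposable (R M : Type*) [Ring R] [AddCommGroup M] [Module R M] : Prop :=
  (⊤ : Submodule R M) ≠ ⊥ ∧
  ∀ S T : Submodule R M, S ⊓ T = ⊥ → S ⊔ T = ⊤ → S = ⊥ ∨ T = ⊥

end MSS

universe u v

namespace MSS

variable {F K : Type*} [Field F] [Field K] [Algebra F K]

section Arithmetic

/-- For `x ≡ 1` modulo `p` (modulo `4` if `p = 2`), the sum `1 + x + ⋯ + x ^ (p ^ s - 1)` is
exactly divisible by `p ^ s`. -/
theorem exists_geom_sum_prime_pow_eq {p : ℕ} (hp : p.Prime) (s : ℕ) {x : ℤ}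
    (hx : (p : ℤ) ∣ x - 1) (h2 : p = 2 → (4 : ℤ) ∣ x - 1) :
    ∃ u : ℤ, IsCoprime u (p : ℤ) ∧ ∑ k ∈ Finset.range (p ^ s), x ^ k = (p : ℤ) ^ s * u := by
  induction s generalizing x with
  | zero => exact ⟨1, isCoprime_one_left, by simp⟩
  | succ s ih =>
    have hdvd : x - 1 ∣ x ^ p - 1 := by simpa using sub_dvd_pow_sub_pow x 1 p
    obtain ⟨u, hu, hsum⟩ := ih (x := x ^ p) (hx.trans hdvd) fun h ↦ (h2 h).trans hdvd
    obtain ⟨w, hw⟩ : ∃ w : ℤ, ∑ k ∈ Finset.range p, x ^ k = p * (1 + p * w) := by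
      rcases hp.eq_two_or_odd' with rfl | hodd
      · obtain ⟨f, hf⟩ := h2 rfl
        refine ⟨f, ?_⟩
        simp only [Finset.sum_range_succ, Finset.sum_range_zero]
        push_cast
        linear_combination hf
      · obtain ⟨f, hf⟩ := hx
        obtain ⟨w, hw⟩ := odd_sq_dvd_geom_sum₂_sub (R := ℤ) (a := 1) f hodd
        refine ⟨w, ?_⟩
        obtain rfl : x = 1 + p * f := by linear_combination hf
        simp only [one_pow, mul_one] at hw
        linear_combination hw
    refine ⟨(1 + p * w) * u, IsCoprime.mul_left ⟨1, -w, by ring⟩ hu, ?_⟩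
    have key : ∑ k ∈ Finset.range (p ^ (s + 1)), x ^ k =
        (∑ k ∈ Finset.range p, x ^ k) * ∑ k ∈ Finset.range (p ^ s), (x ^ p) ^ k := by
      rw [pow_succ']
      induction p ^ s with
      | zero => simp
      | succ q ihq =>
        rw [mul_add, mul_one, Finset.sum_range_add, ihq, Finset.sum_range_succ, mul_add,
          Finset.sum_mul _ _ ((x ^ p) ^ q)]
        congr 1
        exact Finset.sum_congr rfl fun k _ ↦ by rw [← pow_mul]; ring
    rw [key, hw, hsum]
    ring

theorem isCoprime_of_not_pow_succ_dvd {p : ℕ} (hp : p.Prime) {t : ℕ} {w : ℤ}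
    (h : ¬ (p : ℤ) ^ (t + 1) ∣ (p : ℤ) ^ t * w) : IsCoprime w (p : ℤ) := by
  refine ((Nat.prime_iff_prime_int.mp hp).coprime_iff_not_dvd.mpr fun hd ↦ h ?_).symm
  rw [pow_succ]
  exact mul_dvd_mul_left _ hd

/-- Lifting the exponent for `d ∈ U_t \ U_{t+1}`. -/
theorem exists_pow_prime_pow_sub_one_eq {p : ℕ} (hp : p.Prime) {d : ℤ} {t : ℕ} (ht : 1 ≤ t)
    (h4 : p = 2 → (4 : ℤ) ∣ d - 1) (hd : (p : ℤ) ^ t ∣ d - 1)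
    (hd' : ¬ (p : ℤ) ^ (t + 1) ∣ d - 1) (b : ℕ) :
    ∃ u : ℤ, IsCoprime u (p : ℤ) ∧ d ^ p ^ b - 1 = (p : ℤ) ^ (t + b) * u := by
  obtain ⟨w, hw⟩ := hd
  rw [hw] at hd'
  obtain ⟨u, hu, hsum⟩ := exists_geom_sum_prime_pow_eq hp b (x := d)
    (hw ▸ (dvd_pow_self _ (by lia)).mul_right w) h4
  refine ⟨w * u, (isCoprime_of_not_pow_succ_dvd hp hd').mul_left hu, ?_⟩
  rw [← geom_sum_mul, hsum, hw]
  ring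

/-- For `d ∈ -U_t \ -U_{t+1}`, the geometric sum of length `2 ^ (b + 1)` is exactly divisible by
`2 ^ (t + b)`. -/
theorem exists_geom_sum_two_pow_eq {d : ℤ} {t : ℕ} (ht : 2 ≤ t) (hd : (2 : ℤ) ^ t ∣ d + 1)
    (hd' : ¬ (2 : ℤ) ^ (t + 1) ∣ d + 1) (b : ℕ) :
    ∃ u : ℤ, IsCoprime u 2 ∧
      ∑ k ∈ Finset.range (2 ^ (b + 1)), d ^ k = (2 : ℤ) ^ (t + b) * u := by
  have h4 : (4 : ℤ) ∣ d + 1 := (show (4 : ℤ) ∣ 2 ^ t from pow_dvd_pow (2 : ℤ) ht).trans hd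
  have h4' : (4 : ℤ) ∣ d ^ 2 - 1 := h4.trans ⟨d - 1, by ring⟩
  obtain ⟨w, hw⟩ := hd
  rw [hw] at hd'
  obtain ⟨u, hu, hsum⟩ := exists_geom_sum_prime_pow_eq Nat.prime_two b (x := d ^ 2)
    (dvd_trans (by norm_num) h4') fun _ ↦ h4'
  refine ⟨w * u, (isCoprime_of_not_pow_succ_dvd Nat.prime_two hd').mul_left hu, ?_⟩
  have key : ∀ q : ℕ, ∑ k ∈ Finset.range (2 * q), d ^ k =
      (d + 1) * ∑ k ∈ Finset.range q, (d ^ 2) ^ k := by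
    intro q
    induction q with
    | zero => simp
    | succ q ih =>
      rw [mul_add, mul_one, Finset.sum_range_succ, Finset.sum_range_succ, ih,
        Finset.sum_range_succ, ← pow_mul]
      ring
  rw [pow_succ', key, hsum, hw]
  push_cast
  ring

theorem isCoprime_two_of_four_dvd_add_one {d : ℤ} (h : (4 : ℤ) ∣ d + 1) :
    ∃ u : ℤ, IsCoprime u 2 ∧ d - 1 = 2 * u := by
  obtain ⟨f, hf⟩ := h
  exact ⟨2 * f - 1, ⟨-1, f, by ring⟩, by linear_combination hf⟩

end Arithmetic

section Norms

variable (p : ℕ) (σ : K ≃ₐ[F] K)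

theorem umap_pow_add_apply (k l : ℕ) (γ : Kˣ) :
    umap (σ ^ (k + l)) γ = umap (σ ^ k) (umap (σ ^ l) γ) := by
  ext
  simp [umap, pow_add]

theorem umap_pow_zero_apply (γ : Kˣ) : umap (σ ^ 0) γ = γ := by
  ext
  simp [umap]

theorem normHom_apply (j : ℕ) (γ : Kˣ) :
    normHom p σ j γ = ∏ k ∈ Finset.range (p ^ j), umap (σ ^ k) γ := by
  simp [normHom]

theorem mem_KiU {i : ℕ} {γ : Kˣ} : γ ∈ KiU p σ i ↔ umap (σ ^ p ^ i) γ = γ := by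
  simp [KiU, MonoidHom.mem_ker, div_eq_one]

variable {p σ}

theorem umap_pow_mul_of_fixed {q : ℕ} {γ : Kˣ} (h : umap (σ ^ q) γ = γ) (k : ℕ) :
    umap (σ ^ (q * k)) γ = γ := by
  induction k with
  | zero => exact umap_pow_zero_apply σ γ
  | succ k ih => rw [mul_add, mul_one, umap_pow_add_apply, h, ih]

theorem mem_KiU_of_le {i j : ℕ} (hij : i ≤ j) {γ : Kˣ} (h : γ ∈ KiU p σ i) :
    γ ∈ KiU p σ j := by
  rw [mem_KiU] at h ⊢
  obtain ⟨k, rfl⟩ := Nat.exists_eq_add_of_le hij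
  rw [pow_add]
  exact umap_pow_mul_of_fixed h _

theorem prod_range_mul_eq {M : Type*} [CommMonoid M] (f : ℕ → M) (q r : ℕ) :
    ∏ l ∈ Finset.range (q * r), f l =
      ∏ l ∈ Finset.range q, ∏ k ∈ Finset.range r, f (l + q * k) := by
  induction r with
  | zero => simp
  | succ r ih =>
    rw [mul_add, mul_one, Finset.prod_range_add, ih, ← Finset.prod_mul_distrib]
    exact Finset.prod_congr rfl fun l _ ↦ by rw [Finset.prod_range_succ, add_comm (q * r)]

theorem normHom_add_of_mem {j : ℕ} {γ : Kˣ} (h : γ ∈ KiU p σ j) (k : ℕ) :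
    normHom p σ (j + k) γ = normHom p σ j γ ^ p ^ k := by
  rw [mem_KiU] at h
  rw [normHom_apply, normHom_apply, pow_add, prod_range_mul_eq, ← Finset.prod_pow]
  refine Finset.prod_congr rfl fun l _ ↦ ?_
  simp [umap_pow_add_apply, umap_pow_mul_of_fixed h]

/-- The relative norm from `K_{b+s}` to `K_b`, as a product of conjugates. -/
noncomputable def relNorm (p : ℕ) (σ : K ≃ₐ[F] K) (b s : ℕ) : Kˣ →* Kˣ :=
  ∏ k ∈ Finset.range (p ^ s), umap (σ ^ (p ^ b * k))

theorem relNorm_apply (b s : ℕ) (γ : Kˣ) :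
    relNorm p σ b s γ = ∏ k ∈ Finset.range (p ^ s), umap (σ ^ (p ^ b * k)) γ := by
  simp [relNorm]

theorem normHom_relNorm (b s : ℕ) (γ : Kˣ) :
    normHom p σ b (relNorm p σ b s γ) = normHom p σ (b + s) γ := by
  rw [normHom_apply, normHom_apply, pow_add, prod_range_mul_eq, relNorm_apply]
  simp only [map_prod, umap_pow_add_apply]

theorem relNorm_mem {b s : ℕ} {γ : Kˣ} (h : γ ∈ KiU p σ (b + s)) :
    relNorm p σ b s γ ∈ KiU p σ b := by
  rw [mem_KiU] at h ⊢
  rw [relNorm_apply, map_prod]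
  have h1 : ∀ k, umap (σ ^ p ^ b) (umap (σ ^ (p ^ b * k)) γ) = umap (σ ^ (p ^ b * (k + 1))) γ :=
    fun k ↦ by rw [← umap_pow_add_apply, mul_add, mul_one, add_comm]
  simp only [h1]
  have h2 := Finset.prod_range_succ (fun k ↦ umap (σ ^ (p ^ b * k)) γ) (p ^ s)
  rw [Finset.prod_range_succ', ← pow_add, h, mul_zero, umap_pow_zero_apply] at h2
  exact mul_right_cancel h2

/-- The contribution to the root of unity of an element in slot `0`, for a relative norm. -/
theorem normHom_pred_relNorm_pow {n b s e : ℕ} (hb : b < n) (hbs : b + s ≤ n) (he : 1 ≤ s + e)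
    {γ : Kˣ} (h : γ ∈ KiU p σ (b + s)) :
    normHom p σ (n - 1) (relNorm p σ b s γ) ^ p ^ e = normHom p σ n γ ^ p ^ (s + e - 1) := by
  obtain ⟨k, hk⟩ := Nat.exists_eq_add_of_le (show b ≤ n - 1 by lia)
  obtain ⟨l, rfl⟩ := Nat.exists_eq_add_of_le hbs
  rw [hk, normHom_add_of_mem (relNorm_mem h), normHom_relNorm, normHom_add_of_mem h, ← pow_mul,
    ← pow_mul, ← pow_add, ← pow_add, show k + e = l + (s + e - 1) by lia]

theorem normHom_umap_pow {n : ℕ} (horder : σ ^ p ^ n = 1) (k : ℕ) (γ : Kˣ) :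
    normHom p σ n (umap (σ ^ k) γ) = normHom p σ n γ := by
  have hone : ∀ γ : Kˣ, normHom p σ n (umap σ γ) = normHom p σ n γ := fun γ ↦ by
    have h1 : ∀ l, umap (σ ^ l) (umap σ γ) = umap (σ ^ (l + 1)) γ := fun l ↦ by
      rw [umap_pow_add_apply, pow_one]
    rw [normHom_apply, normHom_apply]
    simp only [h1]
    have h2 := Finset.prod_range_succ (fun k ↦ umap (σ ^ k) γ) (p ^ n)
    rw [Finset.prod_range_succ', horder, umap_pow_zero_apply, ← pow_zero σ,
      umap_pow_zero_apply] at h2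
    exact mul_right_cancel h2
  induction k with
  | zero => rw [umap_pow_zero_apply]
  | succ k ih => rw [add_comm, umap_pow_add_apply, pow_one, hone, ih]

/-- `σ - d` divides `σ ^ q - d ^ q`, with control of the norm of the cofactor. -/
theorem exists_cofactor_pow {n : ℕ} (horder : σ ^ p ^ n = 1) (d : ℤ) (q : ℕ) (γ : Kˣ) :
    ∃ (β : Kˣ) (z : ℤ), umap σ β = β ^ d * umap (σ ^ q) γ * γ ^ (-d ^ q) ∧
      normHom p σ n β = normHom p σ n γ ^ z ∧ (d - 1) * z = d ^ q - 1 := by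
  induction q with
  | zero => exact ⟨1, 0, by rw [umap_pow_zero_apply]; simp, by simp, by simp⟩
  | succ q ih =>
    obtain ⟨β, z, h1, h2, h3⟩ := ih
    refine ⟨umap (σ ^ q) γ * β ^ d, 1 + d * z, ?_, ?_, by linear_combination d * h3⟩
    · have h4 : umap (σ ^ (q + 1)) γ = umap σ (umap (σ ^ q) γ) := by
        rw [add_comm, umap_pow_add_apply, pow_one]
      rw [map_mul, map_zpow, h1, h4]
      simp only [mul_zpow, ← zpow_mul, pow_succ]
      rw [neg_mul]
      simp only [mul_comm, mul_left_comm]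
    · rw [map_mul, map_zpow, normHom_umap_pow horder, h2, zpow_add, zpow_one,
        ← zpow_mul, mul_comm z]

theorem zpow_sum_eq_prod {G : Type*} [CommGroup G] (g : G) (f : ℕ → ℤ) (s : Finset ℕ) :
    g ^ ∑ k ∈ s, f k = ∏ k ∈ s, g ^ f k := by
  induction s using Finset.induction_on with
  | empty => simp
  | insert k s hk ih => rw [Finset.sum_insert hk, Finset.prod_insert hk, zpow_add, ih]

/-- `σ - d` divides the difference of a relative norm and the corresponding power of `d`-twisted
norms, with control of the norm of the cofactor. -/
theorem exists_cofactor_relNorm {n : ℕ} (horder : σ ^ p ^ n = 1) (d : ℤ) (b s : ℕ) (γ : Kˣ) :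
    ∃ (β : Kˣ) (z : ℤ),
      umap σ β = β ^ d * relNorm p σ b s γ * γ ^ (-∑ k ∈ Finset.range (p ^ s), (d ^ p ^ b) ^ k) ∧
      normHom p σ n β = normHom p σ n γ ^ z ∧
      (d - 1) * z = ∑ k ∈ Finset.range (p ^ s), (d ^ p ^ b) ^ k - (p : ℤ) ^ s := by
  choose β z h1 h2 h3 using fun k ↦ exists_cofactor_pow horder d (p ^ b * k) γ
  refine ⟨∏ k ∈ Finset.range (p ^ s), β k, ∑ k ∈ Finset.range (p ^ s), z k, ?_, ?_, ?_⟩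
  · rw [map_prod, relNorm_apply, Finset.prod_congr rfl fun k _ ↦ h1 k]
    simp only [Finset.prod_mul_distrib, Finset.prod_zpow, ← pow_mul]
    rw [← Finset.sum_neg_distrib, ← zpow_sum_eq_prod]
  · rw [map_prod, Finset.prod_congr rfl fun k _ ↦ h2 k, ← zpow_sum_eq_prod]
  · rw [Finset.mul_sum, Finset.sum_congr rfl fun k _ ↦ h3 k]
    simp [pow_mul]

end Norms

section Slots

theorem zpow_pow_comm {G : Type*} [Group G] (x : G) (z : ℤ) (k : ℕ) :
    (x ^ z) ^ k = (x ^ k) ^ z := by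
  rw [← zpow_natCast, ← zpow_natCast, ← zpow_mul, ← zpow_mul, mul_comm]

variable (p n : ℕ) (σ : K ≃ₐ[F] K)

/-- The elements allowed at level `a`, as a subgroup. -/
def levelSubgroup (a : WithBot ℕ) : Subgroup Kˣ :=
  WithBot.recBotCoe ⊥ (fun i ↦ KiU p σ i) a

/-- The contribution of an element in slot `l` to the root of unity. -/
noncomputable def slotHom (l : ℕ) : Kˣ →* Kˣ :=
  if l = 0 then normHom p σ (n - 1) else (powMonoidHom (p ^ (l - 1))).comp (normHom p σ n)

variable {p n σ}

theorem levelMem_iff {a : WithBot ℕ} {γ : Kˣ} :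
    levelMem p σ a γ ↔ γ ∈ levelSubgroup p σ a := by
  cases a
  · exact Subgroup.mem_bot.symm
  · rfl

theorem levelMem_coe {a : ℕ} {γ : Kˣ} : levelMem p σ (a : WithBot ℕ) γ ↔ γ ∈ KiU p σ a := Iff.rfl

theorem slotHom_zero (γ : Kˣ) : slotHom p n σ 0 γ = normHom p σ (n - 1) γ := by
  simp [slotHom]

theorem slotHom_of_pos {l : ℕ} (hl : 1 ≤ l) (γ : Kˣ) :
    slotHom p n σ l γ = normHom p σ n γ ^ p ^ (l - 1) := by
  simp [slotHom, show l ≠ 0 by lia]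

theorem prod_slotHom (m : ℕ) (δ : ℕ → Kˣ) :
    ∏ l ∈ Finset.range (m + 1), slotHom p n σ l (δ l) =
      normHom p σ (n - 1) (δ 0) * ∏ l ∈ Finset.Icc 1 m, normHom p σ n (δ l) ^ p ^ (l - 1) := by
  rw [Finset.prod_range_succ', slotHom_zero, mul_comm]
  congr 1
  rw [← Finset.Ico_add_one_right_eq_Icc, Finset.prod_Ico_eq_prod_range]
  exact Finset.prod_congr (by simp) fun l _ ↦ by rw [add_comm 1 l, slotHom_of_pos (by lia)]

theorem prod_range_map_mulSingle {M N : Type*} [CommMonoid M] [CommMonoid N] (f : ℕ → M →* N)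
    {r q : ℕ} (hr : r < q) (x : M) :
    ∏ l ∈ Finset.range q, f l ((Pi.mulSingle r x : ℕ → M) l) = f r x := by
  rw [Finset.prod_eq_single r]
  · simp
  · intro l _ hl
    simp [hl]
  · simp [hr]

theorem prod_range_map_move {M N : Type*} [CommGroup M] [CommGroup N] (f : ℕ → M →* N)
    {r i q : ℕ} (hr : r < q) (hi : i < q) (δ : ℕ → M) (x y : M) (u w : ℤ) :
    ∏ l ∈ Finset.range q,
        f l ((δ l ^ u * ((Pi.mulSingle r x : ℕ → M) l * (Pi.mulSingle i y : ℕ → M) l)) ^ w) =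
      ((∏ l ∈ Finset.range q, f l (δ l)) ^ u * (f r x * f i y)) ^ w := by
  simp only [map_zpow, map_mul, Finset.prod_zpow, Finset.prod_mul_distrib,
    prod_range_map_mulSingle f hr, prod_range_map_mulSingle f hi]

/-- A nonempty slot `r` of a minimal norm pair cannot be moved into a smaller slot `i` (at the
level allowed there) up to multiplication by an integer prime to `p` and the image of `σ - d`. -/
theorem IsMinimalNormPair.false_of_move {m : ℕ} {a : Fin m → WithBot ℕ} {d : ℤ} {ξ α : Kˣ}
    {δ : ℕ → Kˣ} (hmin : IsMinimalNormPair p n σ ξ a d) (hrep : Represents p n σ ξ a d α δ)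
    (hξ : ξ ^ p = 1) {r i : ℕ} (hr : r < m) (hir : i < r) (har : a ⟨r, hr⟩ ≠ ⊥) {u : ℤ}
    (hu : IsCoprime u (p : ℤ)) {β γ : Kˣ} (hγ : levelMem p σ (a ⟨i, hir.trans hr⟩) γ)
    (hβ : umap σ β = β ^ d * (δ r ^ u) ^ p ^ r * (γ ^ p ^ i)⁻¹)
    (hN : normHom p σ n β ^ ((d - 1) / (p : ℤ)) * slotHom p n σ r (δ r ^ u) =
      slotHom p n σ i γ) : False := by
  obtain ⟨⟨ha1, ha2, hd, -⟩, hle⟩ := hmin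
  obtain ⟨hlev, hrel, hroot⟩ := hrep
  obtain ⟨w, v, hwv⟩ := hu
  have hlt : ∀ l, Function.update a ⟨r, hr⟩ ⊥ l ≤ a l := fun l ↦ by
    rcases eq_or_ne l ⟨r, hr⟩ with rfl | h
    · simp
    · rw [Function.update_of_ne h]
  set g : ℕ → Kˣ := fun l ↦ (Pi.mulSingle r (δ r ^ u)⁻¹ : ℕ → Kˣ) l *
    (Pi.mulSingle i γ : ℕ → Kˣ) l with hg
  have hnew : IsNormPair p n σ ξ (Function.update a ⟨r, hr⟩ ⊥) d := by
    refine ⟨fun l ↦ (hlt l).trans (ha1 l), fun h0 ↦ (hlt _).trans_lt (ha2 h0), hd,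
      (α ^ u * β⁻¹) ^ w, fun l ↦ (δ l ^ u * g l) ^ w, fun l ↦ ?_, ?_, ?_⟩
    · rw [levelMem_iff]
      refine Subgroup.zpow_mem _ ?_ _
      rcases eq_or_ne l ⟨r, hr⟩ with rfl | h
      · simp [hg, hir.ne']
      · have hlr : (l : ℕ) ≠ r := fun h' ↦ h (Fin.ext h')
        rw [Function.update_of_ne h]
        refine Subgroup.mul_mem _ (Subgroup.zpow_mem _ (levelMem_iff.mp (hlev l)) _) ?_
        rcases eq_or_ne (l : ℕ) i with h' | h'
        · obtain rfl : l = ⟨i, hir.trans hr⟩ := Fin.ext h'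
          simpa [hg, hir.ne] using levelMem_iff.mp hγ
        · simp [hg, hlr, h']
    · have h1 : ∏ l ∈ Finset.range (m + 1), ((δ l ^ u * g l) ^ w) ^ p ^ l =
          ((∏ l ∈ Finset.range (m + 1), δ l ^ p ^ l) ^ u *
            (((δ r ^ u)⁻¹) ^ p ^ r * γ ^ p ^ i)) ^ w := 
        prod_range_map_move (fun l ↦ powMonoidHom (p ^ l)) (by lia) (by lia) δ _ γ u w
      rw [h1, map_zpow, map_mul, map_zpow, map_inv, hrel, hβ]
      simp only [mul_zpow, inv_zpow, mul_inv, inv_inv, inv_pow, ← zpow_mul]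
      ac_rfl
    · have h1 : ∏ l ∈ Finset.range (m + 1), slotHom p n σ l ((δ l ^ u * g l) ^ w) =
          ((∏ l ∈ Finset.range (m + 1), slotHom p n σ l (δ l)) ^ u *
            ((slotHom p n σ r (δ r ^ u))⁻¹ * slotHom p n σ i γ)) ^ w := 
        (prod_range_map_move (slotHom p n σ) (by lia) (by lia) δ _ γ u w).trans
          (by rw [map_inv])
      have hξw : ξ = (ξ ^ u) ^ w := by
        have hpz : (ξ ^ p) ^ v = ξ ^ (v * (p : ℤ)) := by
          rw [mul_comm, zpow_mul, zpow_natCast]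
        rw [hξ, one_zpow] at hpz
        rw [← zpow_mul, mul_comm u, ← mul_one (ξ ^ (w * u)), hpz, ← zpow_add, hwv, zpow_one]
      rw [mul_assoc, ← prod_slotHom] at hroot
      rw [mul_assoc, ← prod_slotHom m fun l ↦ (δ l ^ u * g l) ^ w]
      rw [h1, ← hN]
      conv_lhs => rw [hξw, hroot]
      rw [map_zpow, map_mul, map_zpow, map_inv, mul_comm (_ ^ ((d - 1) / (p : ℤ)))
        (slotHom p n σ r (δ r ^ u)), inv_mul_cancel_left, zpow_comm (_ * _) w, ← mul_zpow]
      congr 1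
      rw [mul_zpow, mul_zpow, inv_zpow, zpow_comm _ u, mul_assoc, mul_left_comm (_ ⁻¹),
        inv_mul_cancel, mul_one]
  rcases hle _ _ hnew with ⟨k, -, hk⟩ | ⟨hk, -⟩
  · exact (hk.trans_le (hlt k)).false
  · exact har (by rw [hk]; simp)

theorem IsMinimalNormPair.false_of_pow_sub_one {m : ℕ} {a : Fin m → WithBot ℕ} {d : ℤ} {ξ : Kˣ}
    (hmin : IsMinimalNormPair p n σ ξ a d) (hp : p.Prime) (horder : σ ^ p ^ n = 1)
    (hξ : ξ ^ p = 1) {r b v : ℕ} (hr : r < m) (har : a ⟨r, hr⟩ = b) (hv : 1 ≤ v) (hvr : v ≤ r)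
    {u : ℤ} (hu : IsCoprime u (p : ℤ)) (hd : d ^ p ^ b - 1 = (p : ℤ) ^ v * u) : False := by
  obtain ⟨α, δ, hrep⟩ := hmin.1.2.2.2
  obtain ⟨c, hc⟩ := hmin.1.2.2.1
  have hp0 : (p : ℤ) ≠ 0 := by exact_mod_cast hp.ne_zero
  have hδ : umap (σ ^ p ^ b) (δ r) = δ r := by
    have := hrep.1 ⟨r, hr⟩
    rwa [har, levelMem_coe, mem_KiU] at this
  obtain ⟨β, z, h1, h2, h3⟩ := exists_cofactor_pow horder d (p ^ b) (δ r)
  obtain ⟨e, rfl⟩ := Nat.exists_eq_add_of_le hvr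
  have hz : c * z = (p : ℤ) ^ (v - 1) * u := by
    obtain ⟨v, rfl⟩ := Nat.exists_eq_add_of_le' hv
    refine mul_left_cancel₀ hp0 ?_
    rw [Nat.add_sub_cancel]
    linear_combination h3 + hd - z * hc
  have hβ : umap σ β = β ^ d * (δ (v + e) ^ ((p : ℤ) ^ v * u))⁻¹ := by
    rw [h1, hδ, ← hd, mul_assoc, ← zpow_neg, ← zpow_one_add]
    congr 2
    ring
  refine hmin.false_of_move hrep hξ hr (show 0 < v + e by lia) (by simp [har]) hu
    (β := (β ^ p ^ e)⁻¹) (γ := 1) (levelMem_iff.mpr (Subgroup.one_mem _)) ?_ ?_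
  · rw [map_inv, map_pow, hβ, one_pow, inv_one, mul_one, mul_pow, mul_inv, inv_pow, inv_inv,
      ← zpow_natCast (δ (v + e) ^ u), ← zpow_mul, inv_zpow, zpow_pow_comm,
      ← zpow_natCast (δ (v + e) ^ ((p : ℤ) ^ v * u)), ← zpow_mul]
    congr 2
    push_cast
    ring
  · rw [hc, Int.mul_ediv_cancel_left _ hp0, map_one, slotHom_of_pos (by lia), map_inv, map_pow,
      h2, map_zpow]
    simp only [← zpow_natCast, ← zpow_mul, ← zpow_neg, ← zpow_add]
    rw [show v + e - 1 = v - 1 + e by lia]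
    convert zpow_zero _ using 2
    push_cast
    linear_combination -(p : ℤ) ^ e * hz

theorem IsMinimalNormPair.false_of_geom_sum {m : ℕ} {a : Fin m → WithBot ℕ} {d : ℤ} {ξ : Kˣ}
    (hmin : IsMinimalNormPair p n σ ξ a d) (hp : p.Prime) (horder : σ ^ p ^ n = 1)
    (hξ : ξ ^ p = 1) {r i b c s v : ℕ} (hr : r < m) (hir : i < r)
    (har : a ⟨r, hr⟩ = c) (hai : a ⟨i, hir.trans hr⟩ = b) (hcb : c ≤ b + s) (hbs : b + s ≤ n)
    (hvr : i + v ≤ r) (hsv : v < s + r) {u : ℤ} (hu : IsCoprime u (p : ℤ))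
    (hd : ∑ k ∈ Finset.range (p ^ s), (d ^ p ^ b) ^ k = (p : ℤ) ^ v * u) : False := by
  obtain ⟨α, δ, hrep⟩ := hmin.1.2.2.2
  obtain ⟨f, hf⟩ := hmin.1.2.2.1
  have hp0 : (p : ℤ) ≠ 0 := by exact_mod_cast hp.ne_zero
  have hδ : δ r ∈ KiU p σ (b + s) := by
    have := hrep.1 ⟨r, hr⟩
    rw [har, levelMem_coe] at this
    exact mem_KiU_of_le hcb this
  obtain ⟨β, z, h1, h2, h3⟩ := exists_cofactor_relNorm horder d b s (δ r)
  obtain ⟨e, rfl⟩ := Nat.exists_eq_add_of_le hvr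
  set γ := relNorm p σ b s (δ (i + v + e))
  have hz : f * -z * (p : ℤ) ^ (i + e) + u * p ^ (i + v + e - 1) = p ^ (s + (i + e) - 1) := by
    refine mul_left_cancel₀ hp0 ?_
    rw [mul_add, mul_left_comm (p : ℤ) u, ← pow_succ', ← pow_succ',
      show i + v + e - 1 + 1 = i + e + v by lia,
      show s + (i + e) - 1 + 1 = s + (i + e) by lia]
    rw [hd] at h3
    rw [hf] at h3
    simp only [pow_add] at h3 ⊢
    linear_combination -(p : ℤ) ^ i * p ^ e * h3
  refine hmin.false_of_move hrep hξ hr hir (by simp [har]) hu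
    (β := (β ^ p ^ (i + e))⁻¹) (γ := γ ^ p ^ e) ?_ ?_ ?_
  · rw [hai, levelMem_coe]
    exact Subgroup.pow_mem _ (relNorm_mem hδ) _
  · rw [map_inv, map_pow, h1, ← pow_mul, ← pow_add, add_comm e, mul_pow, mul_pow, mul_inv, mul_inv,
      mul_right_comm]
    congr 2
    · rw [zpow_pow_comm, inv_zpow]
    · simp only [← zpow_natCast, ← zpow_mul, ← zpow_neg]
      congr 1
      rw [hd]
      push_cast
      ring
  · rw [hf, Int.mul_ediv_cancel_left _ hp0, slotHom_of_pos (by lia), map_inv, map_pow, h2, map_zpow]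
    trans normHom p σ n (δ (i + v + e)) ^ p ^ (s + (i + e) - 1)
    · simp only [← zpow_natCast, ← zpow_mul, ← zpow_neg, ← zpow_add]
      congr 1
      push_cast
      linear_combination hz
    · rcases i.eq_zero_or_pos with rfl | hi
      · have hb : b < n := by
          have := hmin.1.2.1 (by lia)
          rw [hai] at this
          exact_mod_cast this
        rw [slotHom_zero, map_pow, normHom_pred_relNorm_pow hb hbs (by lia) hδ, zero_add, zero_add]
      · obtain ⟨l, rfl⟩ := Nat.exists_eq_add_of_le hbs
        rw [slotHom_of_pos hi, map_pow, add_assoc b, normHom_add_of_mem (relNorm_mem hδ),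
          normHom_relNorm, ← add_assoc, normHom_add_of_mem hδ]
        simp only [← pow_mul, ← pow_add]
        congr 2
        lia

end Slots

end MSS

/-- **Proposition (norm pair inequalities).**  Let `(a, d)` be a minimal norm
pair of length `m`.  Then (1) `a_i + j < a_{i+j}` for `0 ≤ i < m`,
`1 ≤ j < m - i`, `a_i, a_{i+j} ≠ -∞`, except possibly when `p = 2`, `d ∉ U_2`
and `i = a_i = 0`; (2) if `p > 2` or `d ∈ U_2`, and `d ∈ U_t \ U_{t+1}` with
`1 ≤ t < m`, or if `p = 2` and `d ∈ -U_t \ -U_{t+1}` with `t ≥ 2`, then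
`a_{t+k} > k` for `0 ≤ k < m - t` with `a_{t+k} ≠ -∞`; (3) if `p = 2`,
`a_0 = 0` and `d ∈ -U_t \ -U_{t+1}` with `t ≥ 2`, then `a_{t+k-1} > k` for
`0 ≤ k ≤ m - t` with `a_{t+k-1} ≠ -∞`. -/
theorem statement_12 {F : Type u} {K : Type v} [Field F] [Field K] [Algebra F K]
    [IsGalois F K] [FiniteDimensional F K]
    (p n m : ℕ) (hp : p.Prime) (hn : 0 < n) (hm : 0 < m)
    (σ : K ≃ₐ[F] K) (horder : orderOf σ = p ^ n)
    (hgen : ∀ τ : K ≃ₐ[F] K, τ ∈ Subgroup.zpowers σ)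
    (ξ : Kˣ) (hξ : IsPrimitiveRoot (ξ : K) p)
    (hξF : (ξ : K) ∈ Set.range (algebraMap F K))
    (hspecial : p = 2 → n = 1 → ∃ γ : Kˣ, MSS.normHom p σ n γ = -1)
    (a : Fin m → WithBot ℕ) (d : ℤ)
    (hmin : MSS.IsMinimalNormPair p n σ ξ a d) :
    (∀ (i j : ℕ) (hi : i < m) (hj1 : 1 ≤ j) (hj2 : j < m - i) (hij : i + j < m),
      a ⟨i, hi⟩ ≠ ⊥ → a ⟨i + j, hij⟩ ≠ ⊥ →
      ¬ (p = 2 ∧ ¬ ((4 : ℤ) ∣ d - 1) ∧ i = 0 ∧ a ⟨i, hi⟩ = ((0 : ℕ) : WithBot ℕ)) →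
      a ⟨i, hi⟩ + (j : WithBot ℕ) < a ⟨i + j, hij⟩) ∧
    (∀ t k : ℕ,
      (((2 < p ∨ (4 : ℤ) ∣ d - 1) ∧ 1 ≤ t ∧ t < m ∧
          (p : ℤ) ^ t ∣ d - 1 ∧ ¬ ((p : ℤ) ^ (t + 1) ∣ d - 1)) ∨
        (p = 2 ∧ 2 ≤ t ∧ (2 : ℤ) ^ t ∣ d + 1 ∧ ¬ ((2 : ℤ) ^ (t + 1) ∣ d + 1))) →
      k < m - t → ∀ htk : t + k < m, a ⟨t + k, htk⟩ ≠ ⊥ →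
      (k : WithBot ℕ) < a ⟨t + k, htk⟩) ∧
    (∀ t k : ℕ, p = 2 → a ⟨0, hm⟩ = ((0 : ℕ) : WithBot ℕ) →
      2 ≤ t → (2 : ℤ) ^ t ∣ d + 1 → ¬ ((2 : ℤ) ^ (t + 1) ∣ d + 1) →
      k ≤ m - t → ∀ h : t + k - 1 < m, a ⟨t + k - 1, h⟩ ≠ ⊥ →
      (k : WithBot ℕ) < a ⟨t + k - 1, h⟩) := by
  have horder' : σ ^ p ^ n = 1 := by rw [← horder, pow_orderOf_eq_one]
  have hξ1 : ξ ^ p = 1 := Units.ext (by simpa using hξ.pow_eq_one)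
  have hd1 : (p : ℤ) ∣ d - 1 := hmin.1.2.2.1
  have h4of : ¬ (4 : ℤ) ∣ d - 1 → p = 2 → (4 : ℤ) ∣ d + 1 := by
    rintro h rfl
    push_cast at hd1
    lia
  have h4of' : ∀ t : ℕ, 2 ≤ t → (2 : ℤ) ^ t ∣ d + 1 → (4 : ℤ) ∣ d + 1 := fun t ht h ↦
    (show (4 : ℤ) ∣ 2 ^ t from pow_dvd_pow (2 : ℤ) ht).trans h
  have hzero : ∀ r (hr : r < m), p = 2 → (4 : ℤ) ∣ d + 1 → 1 ≤ r →
      a ⟨r, hr⟩ ≠ ((0 : ℕ) : WithBot ℕ) := by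
    rintro r hr rfl h4 hr1 har
    obtain ⟨u, hu, h⟩ := MSS.isCoprime_two_of_four_dvd_add_one h4
    exact hmin.false_of_pow_sub_one hp horder' hξ1 hr har le_rfl hr1 hu (by simpa using h)
  refine ⟨?_, ?_, ?_⟩
  · intro i j hi hj1 hj2 hij hai haj hexc
    obtain ⟨b, hb⟩ : ∃ b : ℕ, (b : WithBot ℕ) = _ := WithBot.ne_bot_iff_exists.mp hai
    obtain ⟨c, hc⟩ : ∃ c : ℕ, (c : WithBot ℕ) = _ := WithBot.ne_bot_iff_exists.mp haj
    by_contra hlt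
    have hcb : c ≤ b + j := by
      rw [← hb, ← hc, not_lt] at hlt
      exact_mod_cast hlt
    have hbn : b ≤ n := by
      have := hmin.1.1 ⟨i, hi⟩
      rw [← hb] at this
      exact_mod_cast this
    have hcn : c ≤ n := by
      have := hmin.1.1 ⟨i + j, hij⟩
      rw [← hc] at this
      exact_mod_cast this
    have h4 : p = 2 → (4 : ℤ) ∣ d ^ p ^ b - 1 := by
      intro h2
      by_cases h4 : (4 : ℤ) ∣ d - 1
      · exact h4.trans (by simpa using sub_dvd_pow_sub_pow d 1 (p ^ b))
      · have h4' := h4of h4 h2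
        rcases b with _ | b
        · refine (hzero i hi h2 h4' ?_ hb.symm).elim
          by_contra hi0
          exact hexc ⟨h2, h4, by lia, hb.symm⟩
        · subst h2
          rw [pow_succ', pow_mul]
          refine (h4'.trans ⟨d - 1, by ring⟩ : (4 : ℤ) ∣ d ^ 2 - 1).trans ?_
          simpa using sub_dvd_pow_sub_pow (d ^ 2) 1 (2 ^ b)
    obtain ⟨u, hu, hsum⟩ := MSS.exists_geom_sum_prime_pow_eq hp (c - b) (x := d ^ p ^ b)
      (hd1.trans (by simpa using sub_dvd_pow_sub_pow d 1 (p ^ b))) h4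
    exact hmin.false_of_geom_sum hp horder' hξ1 hij (by lia) hc.symm hb.symm (by lia) (by lia)
      (by lia) (by lia) hu hsum
  · intro t k ht hk htk hat
    obtain ⟨c, hc⟩ : ∃ c : ℕ, (c : WithBot ℕ) = _ := WithBot.ne_bot_iff_exists.mp hat
    by_contra hlt
    have hck : c ≤ k := by
      rw [← hc, not_lt] at hlt
      exact_mod_cast hlt
    rcases ht with ⟨h4, ht1, -, htd, htd'⟩ | ⟨rfl, ht2, htd, htd'⟩
    · obtain ⟨u, hu, h⟩ := MSS.exists_pow_prime_pow_sub_one_eq hp ht1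
        (fun h ↦ h4.resolve_left (by lia)) htd htd' c
      exact hmin.false_of_pow_sub_one hp horder' hξ1 htk hc.symm (by lia) (by lia) hu h
    · have h4 := h4of' t ht2 htd
      rcases c with _ | c
      · exact hzero _ htk rfl h4 (by lia) hc.symm
      · obtain ⟨w, hw, h⟩ := MSS.isCoprime_two_of_four_dvd_add_one h4
        obtain ⟨u, hu, hsum⟩ := MSS.exists_geom_sum_two_pow_eq ht2 htd htd' c
        refine hmin.false_of_pow_sub_one hp horder' hξ1 htk hc.symm (v := t + c + 1) (by lia)
          (by lia) (u := u * w) (hu.mul_left hw) ?_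
        rw [← geom_sum_mul, hsum, h]
        push_cast
        ring
  · rintro t k rfl h0 ht2 htd htd' hk h hat
    obtain ⟨c, hc⟩ : ∃ c : ℕ, (c : WithBot ℕ) = _ := WithBot.ne_bot_iff_exists.mp hat
    by_contra hlt
    have hck : c ≤ k := by
      rw [← hc, not_lt] at hlt
      exact_mod_cast hlt
    have hcn : c ≤ n := by
      have := hmin.1.1 ⟨t + k - 1, h⟩
      rw [← hc] at this
      exact_mod_cast this
    rcases c with _ | c
    · exact hzero _ h rfl (h4of' t ht2 htd) (by lia) hc.symm
    · obtain ⟨u, hu, hsum⟩ := MSS.exists_geom_sum_two_pow_eq ht2 htd htd' c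
      have hpos : 0 < t + k - 1 := by lia
      exact hmin.false_of_geom_sum hp horder' hξ1 h hpos hc.symm h0 (s := c + 1)
        (v := t + c) (by lia) (by lia) (by lia) (by lia) hu (by simpa using hsum)
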